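/- Relative weak compactness of the specification (Corollary). Fix p ∈ [p₀, q) and α ∈ (α_, ᾱ]. For every ξ ∈ L^p(V,w_α), the family of probability measures {π_Λ(·|ξ) : Λ ⊂ V finite} is uniformly tight and hence relatively compact in the weak topology of probability measures on Ω = ℝ^V (with the product topology). -/

import Mathlib

open MeasureTheory Real Filter
open scoped ENNReal

noncomputable section

variable {V : Type} [Countable V] [DecidableEq V]

/-- The configuration equal to `σ` on `Λ` and to `ξ` off `Λ`. -/
def comb (Λ : Finset V) (σ : ↥Λ → ℝ) (ξ : V → ℝ) : V → ℝ :=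
  fun x => if h : x ∈ Λ then σ ⟨x, h⟩ else ξ x

/-- The relative local Hamiltonian `H_Λ(·|ξ)`, evaluated at the full configuration
`ω = ω_Λ × ξ_{Λᶜ}`: the sum of `W(ω(x),ω(y))` over edges with both ends in `Λ`,
plus the sum of `W(ω(x),ω(y))` over edges with `x ∈ Λ`, `y ∉ Λ`, plus `Σ_{x∈Λ} V(ω(x))`. -/
def ham (G : SimpleGraph V) [∀ v : V, Fintype (G.neighborSet v)]
    (W : ℝ → ℝ → ℝ) (P : ℝ → ℝ) (Λ : Finset V) (ω : V → ℝ) : ℝ :=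
  (∑ x ∈ Λ, ∑ y ∈ G.neighborFinset x ∩ Λ, W (ω x) (ω y)) / 2
    + ∑ x ∈ Λ, ∑ y ∈ G.neighborFinset x \ Λ, W (ω x) (ω y)
    + ∑ x ∈ Λ, P (ω x)

/-- The normalizing constant `Z_Λ(ξ)`. -/
def partZ (G : SimpleGraph V) [∀ v : V, Fintype (G.neighborSet v)]
    (W : ℝ → ℝ → ℝ) (P : ℝ → ℝ) (Λ : Finset V) (ξ : V → ℝ) : ℝ :=
  ∫ σ : ↥Λ → ℝ, Real.exp (- ham G W P Λ (comb Λ σ ξ))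

/-- The local Gibbs specification kernel `π_Λ(·|ξ)`, a measure on `Ω = ℝ^V`. -/
def gibbsKer (G : SimpleGraph V) [∀ v : V, Fintype (G.neighborSet v)]
    (W : ℝ → ℝ → ℝ) (P : ℝ → ℝ) (Λ : Finset V) (ξ : V → ℝ) : Measure (V → ℝ) :=
  (ENNReal.ofReal (partZ G W P Λ ξ))⁻¹ •
    Measure.map (fun σ => comb Λ σ ξ)
      ((volume : Measure (↥Λ → ℝ)).withDensity
        fun σ => ENNReal.ofReal (Real.exp (- ham G W P Λ (comb Λ σ ξ))))

/-- `μ` is a Gibbs measure: a probability measure solving the DLR equation. -/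
def IsGibbsMeasure (G : SimpleGraph V) [∀ v : V, Fintype (G.neighborSet v)]
    (W : ℝ → ℝ → ℝ) (P : ℝ → ℝ) (μ : Measure (V → ℝ)) : Prop :=
  IsProbabilityMeasure μ ∧
    ∀ (Λ : Finset V) (A : Set (V → ℝ)), MeasurableSet A →
      μ A = ∫⁻ ω, gibbsKer G W P Λ ω A ∂μ

/-- The weight `w_α(x) = exp(-α ρ(o,x))`. -/
def wgt (G : SimpleGraph V) (o : V) (α : ℝ) (x : V) : ℝ :=
  Real.exp (-α * (G.dist o x : ℝ))

/-- `‖ω‖_{p,α}^p = Σ_{x∈V} |ω(x)|^p w_α(x)`. -/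
def sNorm (G : SimpleGraph V) (o : V) (p α : ℝ) (ω : V → ℝ) : ℝ :=
  ∑' x : V, |ω x| ^ p * wgt G o α x

/-- The set `L^p(V, w_α)` of tempered configurations. -/
def tempered (G : SimpleGraph V) (o : V) (p α : ℝ) : Set (V → ℝ) :=
  {ω | Summable fun x : V => |ω x| ^ p * wgt G o α x}

/-- The summability `Θ(α,θ) = Σ_x Σ_{y∼x} [n(x)n(y)]^θ w_α(x) < ∞`. -/
def ThetaFin (G : SimpleGraph V) [∀ v : V, Fintype (G.neighborSet v)]
    (o : V) (α θ : ℝ) : Prop :=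
  Summable fun x : V =>
    (∑ y ∈ G.neighborFinset x, ((G.degree x : ℝ) * (G.degree y : ℝ)) ^ θ) * wgt G o α x


/-- A weighted Young-type inequality without multiplicative constants. -/
lemma rpow_le_mul_rpow_add_rpow_neg {r θ p δ t : ℝ} (hr : 0 < r) (hθ : 0 < θ)
    (hp : r + r / θ ≤ p) (hδ : 0 < δ) (hδ1 : δ ≤ 1) (ht : 0 ≤ t) :
    t ^ r ≤ δ * t ^ p + δ ^ (-θ) := by
  have hδθ : 0 < δ ^ (-θ) := rpow_pos_of_pos hδ _
  have htp : 0 ≤ t ^ p := rpow_nonneg ht _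
  rcases le_total (t ^ r) (δ ^ (-θ)) with h | h
  · nlinarith [mul_nonneg hδ.le htp]
  have h1 : (1 : ℝ) ≤ δ ^ (-θ) := one_le_rpow_of_pos_of_le_one_of_nonpos hδ hδ1 (by linarith)
  have ht0 : 0 < t := by
    rcases ht.eq_or_lt with rfl | h0
    · rw [zero_rpow hr.ne'] at h
      linarith
    · exact h0
  have ht1 : 1 ≤ t := by
    by_contra! hlt
    have := rpow_lt_one ht hlt hr
    linarith
  have h2 : δ⁻¹ ≤ t ^ (r / θ) := by
    have h3 : (δ ^ (-θ)) ^ (1 / θ) ≤ (t ^ r) ^ (1 / θ) :=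
      rpow_le_rpow hδθ.le h (by positivity)
    rw [← rpow_mul hδ.le, ← rpow_mul ht] at h3
    have e1 : -θ * (1 / θ) = -1 := by field_simp
    rw [e1, rpow_neg_one] at h3
    simpa [div_eq_mul_inv] using h3
  have h4 : t ^ r * δ⁻¹ ≤ t ^ p := calc
    t ^ r * δ⁻¹ ≤ t ^ r * t ^ (r / θ) := by gcongr
    _ = t ^ (r + r / θ) := (rpow_add ht0 _ _).symm
    _ ≤ t ^ p := rpow_le_rpow_of_exponent_le ht1 hp
  have h5 : t ^ r ≤ δ * t ^ p := by
    have := mul_le_mul_of_nonneg_left h4 hδ.le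
    field_simp at this
    linarith
  linarith

lemma exists_mul_rpow_le_mul_rpow_add {p q K a : ℝ} (hp : 0 < p) (hpq : p < q) (hK : 0 ≤ K)
    (ha : 0 < a) : ∃ C : ℝ, 0 ≤ C ∧ ∀ t : ℝ, 0 ≤ t → K * t ^ p ≤ a * t ^ q + C := by
  set t₀ : ℝ := (K / a) ^ (1 / (q - p))
  have hq : 0 < q - p := by linarith
  refine ⟨K * t₀ ^ p, by positivity, fun t ht => ?_⟩
  have htq : 0 ≤ a * t ^ q := by positivity
  rcases le_total t t₀ with h | h
  · have : K * t ^ p ≤ K * t₀ ^ p := by gcongr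
    linarith
  · have h0 : 0 ≤ K * t₀ ^ p := by positivity
    rcases ht.eq_or_lt with rfl | ht0
    · rw [zero_rpow hp.ne']
      linarith
    have h1 : K / a ≤ t ^ (q - p) := by
      have := rpow_le_rpow (by positivity) h hq.le
      rwa [← rpow_mul (by positivity), one_div_mul_cancel hq.ne', rpow_one] at this
    have h2 : t ^ q = t ^ (q - p) * t ^ p := by rw [← rpow_add ht0]; ring_nf
    have h3 : K ≤ a * t ^ (q - p) := by
      rw [div_le_iff₀ ha] at h1
      linarith
    have h4 : K * t ^ p ≤ a * t ^ (q - p) * t ^ p := by gcongr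
    rw [h2]
    linarith

lemma integrable_exp_neg_mul_abs_rpow {q b : ℝ} (hq : 0 < q) (hb : 0 < b) :
    Integrable fun u : ℝ => exp (-b * |u| ^ q) := by
  refine Integrable.of_integral_ne_zero ?_
  rw [integral_comp_abs (f := fun u => exp (-b * u ^ q)), integral_exp_neg_mul_rpow hq hb]
  have := Gamma_pos_of_pos (show 0 < 1 / q + 1 by positivity)
  positivity

lemma integrable_exp_mul_rpow_sub {p q K a : ℝ} (hp : 0 < p) (hpq : p < q) (hK : 0 ≤ K)
    (ha : 0 < a) : Integrable fun u : ℝ => exp (K * |u| ^ p - a * |u| ^ q) := by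
  have hq : 0 < q := hp.trans hpq
  obtain ⟨C, -, hC⟩ := exists_mul_rpow_le_mul_rpow_add hp hpq hK (half_pos ha)
  have hc : Continuous fun u : ℝ => exp (K * |u| ^ p - a * |u| ^ q) := by
    have h1 := continuous_abs.rpow_const (fun u : ℝ => Or.inr hp.le)
    have h2 := continuous_abs.rpow_const (fun u : ℝ => Or.inr hq.le)
    fun_prop
  refine ((integrable_exp_neg_mul_abs_rpow hq (half_pos ha)).const_mul (exp C)).mono'
    hc.aestronglyMeasurable (Eventually.of_forall fun u => ?_)
  rw [norm_of_nonneg (exp_pos _).le, ← exp_add]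
  gcongr
  have := hC |u| (abs_nonneg u)
  linarith

/-- Moment bound for a one-dimensional Gibbs density, with an explicit dependence on the
boundary values `v`. -/
lemma exists_lintegral_rpow_mul_exp_le {ι : Type*} {W : ℝ → ℝ → ℝ}
    (hWcont : Continuous (Function.uncurry W)) {I J r θ : ℝ} (hI : 0 ≤ I) (hJ : 0 ≤ J)
    (hr : 0 < r) (hθ : 0 < θ)
    (hW : ∀ u v : ℝ, |W u v| ≤ (I + J * (|u| ^ r + |v| ^ r)) / 2)
    {P : ℝ → ℝ} (hPcont : Continuous P) {a c p q : ℝ} (ha : 0 < a) (hc : 0 ≤ c)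
    (hP : ∀ u : ℝ, a * |u| ^ q - c ≤ P u) (hp : r + r / θ ≤ p) (hpq : p < q) :
    ∃ C : ℝ, 0 ≤ C ∧ ∀ (S : Finset ι) (δ v : ι → ℝ), (∀ y ∈ S, 0 < δ y ∧ δ y ≤ 1) →
      ∑ y ∈ S, δ y ≤ 1 →
      ∫⁻ u : ℝ, ENNReal.ofReal (|u| ^ p) * ENNReal.ofReal (exp (-(P u + ∑ y ∈ S, W u (v y))))
        ≤ ENNReal.ofReal (C * (1 + ∑ y ∈ S, δ y ^ (-θ)) + J * ∑ y ∈ S, δ y * |v y| ^ p) *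
          ∫⁻ u : ℝ, ENNReal.ofReal (exp (-(P u + ∑ y ∈ S, W u (v y)))) := by
  have hp0 : 0 < p := lt_of_lt_of_le (by positivity) hp
  obtain ⟨M₀, hM₀⟩ := isCompact_Icc.exists_bound_of_continuousOn
    (s := Set.Icc (0 : ℝ) 1) hPcont.continuousOn
  have hM₀0 : 0 ≤ M₀ := (norm_nonneg _).trans (hM₀ 0 (by simp))
  have hgint := integrable_exp_mul_rpow_sub hp0 hpq (K := 1 + J / 2) (by positivity) ha
  set g : ℝ → ℝ := fun u => exp ((1 + J / 2) * |u| ^ p - a * |u| ^ q) with hg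
  set M : ℝ := ∫ u, g u with hM
  have hM0 : 0 ≤ M := integral_nonneg fun u => (exp_pos _).le
  have hgM : ∫⁻ u, ENNReal.ofReal (g u) = ENNReal.ofReal M :=
    (ofReal_integral_eq_lintegral_ofReal hgint (Eventually.of_forall fun u => (exp_pos _).le)).symm
  refine ⟨M + c + M₀ + 1 + I + 2 * J, by positivity, fun S δ v hδ hδ1 => ?_⟩
  set F : ℝ → ℝ := fun u => P u + ∑ y ∈ S, W u (v y) with hF
  set T := ∑ y ∈ S, δ y ^ (-θ) with hT
  set X := ∑ y ∈ S, δ y * |v y| ^ p with hX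
  set s := ∑ y ∈ S, |v y| ^ r with hs
  have hFc : Continuous F := by
    refine hPcont.add (continuous_finsetSum _ fun y _ => ?_)
    exact hWcont.comp (by fun_prop : Continuous fun u : ℝ => (u, v y))
  have hT0 : 0 ≤ T := Finset.sum_nonneg fun y hy => (rpow_pos_of_pos (hδ y hy).1 _).le
  have hX0 : 0 ≤ X := Finset.sum_nonneg fun y hy =>
    mul_nonneg (hδ y hy).1.le (rpow_nonneg (abs_nonneg _) _)
  have hs0 : 0 ≤ s := Finset.sum_nonneg fun y _ => rpow_nonneg (abs_nonneg _) _
  have hnT : (S.card : ℝ) ≤ T := by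
    rw [Finset.card_eq_sum_ones, Nat.cast_sum]
    refine Finset.sum_le_sum fun y hy => ?_
    simpa using one_le_rpow_of_pos_of_le_one_of_nonpos (hδ y hy).1 (hδ y hy).2
      (by linarith : -θ ≤ 0)
  have hsXT : s ≤ X + T := by
    rw [hs, hX, hT, ← Finset.sum_add_distrib]
    exact Finset.sum_le_sum fun y hy => rpow_le_mul_rpow_add_rpow_neg hr hθ hp (hδ y hy).1
      (hδ y hy).2 (abs_nonneg _)
  have hn : ∀ u : ℝ, S.card * |u| ^ r ≤ |u| ^ p + T := fun u => calc
    S.card * |u| ^ r = ∑ y ∈ S, |u| ^ r := by simp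
    _ ≤ ∑ y ∈ S, (δ y * |u| ^ p + δ y ^ (-θ)) :=
      Finset.sum_le_sum fun y hy => rpow_le_mul_rpow_add_rpow_neg hr hθ hp (hδ y hy).1
        (hδ y hy).2 (abs_nonneg _)
    _ = (∑ y ∈ S, δ y) * |u| ^ p + T := by rw [Finset.sum_add_distrib, Finset.sum_mul]
    _ ≤ 1 * |u| ^ p + T := by gcongr
    _ = |u| ^ p + T := by ring
  have hWs : ∀ u : ℝ, |∑ y ∈ S, W u (v y)| ≤ (I * S.card + J * (S.card * |u| ^ r) + J * s) / 2 := by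
    intro u
    calc |∑ y ∈ S, W u (v y)| ≤ ∑ y ∈ S, |W u (v y)| := Finset.abs_sum_le_sum_abs _ _
      _ ≤ ∑ y ∈ S, (I + J * (|u| ^ r + |v y| ^ r)) / 2 := Finset.sum_le_sum fun y _ => hW _ _
      _ = _ := by
        rw [← Finset.sum_div, Finset.sum_add_distrib, ← Finset.mul_sum, Finset.sum_add_distrib]
        simp only [Finset.sum_const, nsmul_eq_mul, hs]
        ring
  set D := M + c + M₀ + (I + 2 * J) * T + J * X with hD
  have hD0 : 0 ≤ D := by positivity
  have hIT : I * S.card ≤ I * T := by gcongr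
  have hJT : J * S.card ≤ J * T := by gcongr
  have hJs : J * s ≤ J * (X + T) := by gcongr
  set Z := ∫⁻ u, ENNReal.ofReal (exp (-F u)) with hZ
  have hZlow : ENNReal.ofReal (exp (-(M₀ + (I * T + J * T + J * s) / 2))) ≤ Z := by
    calc ENNReal.ofReal (exp (-(M₀ + (I * T + J * T + J * s) / 2)))
        = ∫⁻ _ in Set.Icc (0 : ℝ) 1,
            ENNReal.ofReal (exp (-(M₀ + (I * T + J * T + J * s) / 2))) := by simp
      _ ≤ ∫⁻ u in Set.Icc (0 : ℝ) 1, ENNReal.ofReal (exp (-F u)) := by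
          refine setLIntegral_mono' measurableSet_Icc fun u hu => ?_
          gcongr
          have h1 := (abs_le.1 (hM₀ u hu)).2
          have h2 := (abs_le.1 (hWs u)).2
          have h3 : |u| ^ r ≤ 1 := rpow_le_one (abs_nonneg _)
            (abs_le.2 ⟨by linarith [hu.1], hu.2⟩) hr.le
          have h4 : J * (S.card * |u| ^ r) ≤ J * (S.card * 1) := by gcongr
          simp only [hF]
          linarith
      _ ≤ Z := setLIntegral_le_lintegral _ _
  have hnum : ∫⁻ u, ENNReal.ofReal (exp (|u| ^ p - F u)) ≤ ENNReal.ofReal (exp D) * Z := by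
    calc ∫⁻ u, ENNReal.ofReal (exp (|u| ^ p - F u))
        ≤ ∫⁻ u, ENNReal.ofReal (exp (c + (I * T + J * T + J * s) / 2)) * ENNReal.ofReal (g u) := by
          refine lintegral_mono fun u => ?_
          rw [← ENNReal.ofReal_mul (exp_pos _).le, hg, ← exp_add]
          gcongr
          have h1 := hP u
          have h2 := (abs_le.1 (hWs u)).1
          have h3 : J * (S.card * |u| ^ r) ≤ J * (|u| ^ p + T) :=
            mul_le_mul_of_nonneg_left (hn u) hJ
          simp only [hF]
          linarith
      _ = ENNReal.ofReal (exp (c + (I * T + J * T + J * s) / 2)) * ENNReal.ofReal M := by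
          rw [lintegral_const_mul' _ _ ENNReal.ofReal_ne_top, hgM]
      _ ≤ ENNReal.ofReal (exp (c + (I * T + J * T + J * s) / 2)) * ENNReal.ofReal (exp M) := by
          gcongr
          linarith [add_one_le_exp M]
      _ ≤ ENNReal.ofReal (exp D) *
            ENNReal.ofReal (exp (-(M₀ + (I * T + J * T + J * s) / 2))) := by
          rw [← ENNReal.ofReal_mul (exp_pos _).le, ← ENNReal.ofReal_mul (exp_pos _).le,
            ← exp_add, ← exp_add]
          refine ENNReal.ofReal_le_ofReal (exp_le_exp.2 ?_)
          simp only [hD]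
          linarith
      _ ≤ _ := by gcongr
  have hmeas : Measurable fun u => ENNReal.ofReal (exp (-F u)) := by fun_prop
  calc ∫⁻ u : ℝ, ENNReal.ofReal (|u| ^ p) * ENNReal.ofReal (exp (-F u))
      ≤ ∫⁻ u : ℝ, (ENNReal.ofReal D * ENNReal.ofReal (exp (-F u))
          + ENNReal.ofReal (exp (-D)) * ENNReal.ofReal (exp (|u| ^ p - F u))) := by
        refine lintegral_mono fun u => ?_
        rw [← ENNReal.ofReal_mul (by positivity), ← ENNReal.ofReal_mul hD0,
          ← ENNReal.ofReal_mul (exp_pos _).le, ← ENNReal.ofReal_add (by positivity) (by positivity)]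
        gcongr
        have h1 := add_one_le_exp (|u| ^ p - D)
        have h2 : exp (-D) * exp (|u| ^ p - F u) = exp (|u| ^ p - D) * exp (-F u) := by
          rw [← exp_add, ← exp_add]
          ring_nf
        rw [h2, ← add_mul]
        gcongr
        linarith
    _ = ENNReal.ofReal D * Z
          + ENNReal.ofReal (exp (-D)) * ∫⁻ u, ENNReal.ofReal (exp (|u| ^ p - F u)) := by
        rw [lintegral_add_left (hmeas.const_mul _), lintegral_const_mul' _ _ ENNReal.ofReal_ne_top,
          lintegral_const_mul' _ _ ENNReal.ofReal_ne_top]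
    _ ≤ ENNReal.ofReal D * Z + ENNReal.ofReal (exp (-D)) * (ENNReal.ofReal (exp D) * Z) := by
        gcongr
    _ = ENNReal.ofReal (D + 1) * Z := by
        rw [← mul_assoc, ← ENNReal.ofReal_mul (exp_pos _).le, ← exp_add, neg_add_cancel, exp_zero,
          ENNReal.ofReal_add hD0 zero_le_one, add_mul]
    _ ≤ _ := by
        refine mul_le_mul' (ENNReal.ofReal_le_ofReal ?_) le_rfl
        simp only [hD]
        nlinarith [mul_nonneg (add_nonneg (add_nonneg hM0 hc) hM₀0) hT0]

set_option linter.unusedSectionVars false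

lemma ham_eq_site_add (G : SimpleGraph V) [∀ v : V, Fintype (G.neighborSet v)]
    {W : ℝ → ℝ → ℝ} (hWsym : ∀ u v : ℝ, W u v = W v u) (P : ℝ → ℝ) {Λ : Finset V} {x : V}
    (hx : x ∈ Λ) (ω : V → ℝ) :
    ham G W P Λ ω = (P (ω x) + ∑ y ∈ G.neighborFinset x, W (ω x) (ω y)) +
      ((∑ z ∈ Λ.erase x, ∑ y ∈ (G.neighborFinset z ∩ Λ).erase x, W (ω z) (ω y)) / 2
        + ∑ z ∈ Λ.erase x, ∑ y ∈ G.neighborFinset z \ Λ, W (ω z) (ω y)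
        + ∑ z ∈ Λ.erase x, P (ω z)) := by
  have h1 : ∑ z ∈ Λ.erase x, ∑ y ∈ G.neighborFinset z ∩ Λ, W (ω z) (ω y)
      = ∑ z ∈ Λ.erase x, ∑ y ∈ (G.neighborFinset z ∩ Λ).erase x, W (ω z) (ω y)
        + ∑ y ∈ G.neighborFinset x ∩ Λ, W (ω x) (ω y) := by
    have h2 : ∑ y ∈ G.neighborFinset x ∩ Λ, W (ω x) (ω y)
        = ∑ z ∈ Λ.erase x, if z ∈ G.neighborFinset x then W (ω z) (ω x) else 0 := by
      rw [← Finset.sum_filter]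
      refine Finset.sum_congr ?_ fun y _ => hWsym _ _
      ext y
      simp only [Finset.mem_inter, Finset.mem_filter, Finset.mem_erase,
        SimpleGraph.mem_neighborFinset]
      exact ⟨fun h => ⟨⟨h.1.ne', h.2⟩, h.1⟩, fun h => ⟨h.2, h.1.2⟩⟩
    rw [h2, ← Finset.sum_add_distrib]
    refine Finset.sum_congr rfl fun z _ => ?_
    by_cases hz : z ∈ G.neighborFinset x
    · have hz' : x ∈ G.neighborFinset z ∩ Λ := by
        simp only [SimpleGraph.mem_neighborFinset] at hz
        simp [hz.symm, hx]
      rw [if_pos hz, Finset.sum_erase_add _ _ hz']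
    · have hz' : x ∉ G.neighborFinset z ∩ Λ := by
        simp only [SimpleGraph.mem_neighborFinset] at hz
        exact fun h => hz ((G.mem_neighborFinset z x).1 (Finset.mem_inter.1 h).1).symm
      rw [if_neg hz, Finset.erase_eq_of_notMem hz', add_zero]
  have h3 := Finset.sum_inter_add_sum_sdiff (G.neighborFinset x) Λ (fun y => W (ω x) (ω y))
  rw [ham, ← Finset.add_sum_erase Λ _ hx, ← Finset.add_sum_erase Λ _ hx,
    ← Finset.add_sum_erase Λ (fun x => P (ω x)) hx, h1, ← h3]
  ring

/-- Resampling the spin at `x` changes the local Hamiltonian only through the single-site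
energy. -/
lemma ham_update (G : SimpleGraph V) [∀ v : V, Fintype (G.neighborSet v)]
    {W : ℝ → ℝ → ℝ} (hWsym : ∀ u v : ℝ, W u v = W v u) (P : ℝ → ℝ) {Λ : Finset V} {x : V}
    (hx : x ∈ Λ) (ω : V → ℝ) (u : ℝ) :
    ham G W P Λ (Function.update ω x u) = (P u + ∑ y ∈ G.neighborFinset x, W u (ω y)) +
      (ham G W P Λ ω - (P (ω x) + ∑ y ∈ G.neighborFinset x, W (ω x) (ω y))) := by
  have hup : ∀ y, y ≠ x → Function.update ω x u y = ω y := fun y hy =>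
    Function.update_of_ne hy _ _
  rw [ham_eq_site_add G hWsym P hx, ham_eq_site_add G hWsym P hx ω, add_sub_cancel_left]
  congr 1
  · rw [Function.update_self]
    congr 1
    refine Finset.sum_congr rfl fun y hy => ?_
    rw [hup y ((G.mem_neighborFinset x y).1 hy).ne']
  · congr 1
    · congr 1
      · congr 1
        refine Finset.sum_congr rfl fun z hz => Finset.sum_congr rfl fun y hy => ?_
        rw [hup z (Finset.ne_of_mem_erase hz), hup y (Finset.ne_of_mem_erase hy)]
      · refine Finset.sum_congr rfl fun z hz => Finset.sum_congr rfl fun y hy => ?_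
        rw [hup z (Finset.ne_of_mem_erase hz), hup y]
        rintro rfl
        exact (Finset.mem_sdiff.1 hy).2 hx
    · refine Finset.sum_congr rfl fun z hz => ?_
      rw [hup z (Finset.ne_of_mem_erase hz)]

lemma comb_of_notMem {Λ : Finset V} (σ : ↥Λ → ℝ) (ξ : V → ℝ) {x : V} (hx : x ∉ Λ) :
    comb Λ σ ξ x = ξ x := by
  simp [comb, hx]

lemma comb_coe {Λ : Finset V} (σ : ↥Λ → ℝ) (ξ : V → ℝ) (x : ↥Λ) :
    comb Λ σ ξ x = σ x := by
  simp [comb]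

lemma comb_update {Λ : Finset V} (σ : ↥Λ → ℝ) (ξ : V → ℝ) (x : ↥Λ) (u : ℝ) :
    comb Λ (Function.update σ x u) ξ = Function.update (comb Λ σ ξ) x u := by
  ext y
  by_cases hy : y = x
  · subst hy
    simp [comb]
  · rw [Function.update_of_ne hy]
    by_cases hΛ : y ∈ Λ
    · have : (⟨y, hΛ⟩ : ↥Λ) ≠ x := fun h => hy (congrArg Subtype.val h)
      simp [comb, hΛ, Function.update_of_ne this]
    · simp [comb, hΛ]

lemma continuous_comb (Λ : Finset V) (ξ : V → ℝ) : Continuous fun σ : ↥Λ → ℝ => comb Λ σ ξ := by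
  refine continuous_pi fun x => ?_
  by_cases hx : x ∈ Λ
  · simpa [comb, hx] using continuous_apply _
  · simpa [comb, hx] using continuous_const

lemma continuous_ham (G : SimpleGraph V) [∀ v : V, Fintype (G.neighborSet v)]
    {W : ℝ → ℝ → ℝ} (hW : Continuous (Function.uncurry W)) {P : ℝ → ℝ} (hP : Continuous P)
    (Λ : Finset V) : Continuous (ham G W P Λ) := by
  have h : ∀ x y : V, Continuous fun ω : V → ℝ => W (ω x) (ω y) := fun x y =>
    hW.comp (by fun_prop : Continuous fun ω : V → ℝ => (ω x, ω y))
  unfold ham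
  refine ((Continuous.div_const ?_ _).add ?_).add ?_
  · exact continuous_finsetSum _ fun x _ => continuous_finsetSum _ fun y _ => h x y
  · exact continuous_finsetSum _ fun x _ => continuous_finsetSum _ fun y _ => h x y
  · exact continuous_finsetSum _ fun x _ => by fun_prop

lemma exists_neg_ham_le (G : SimpleGraph V) [∀ v : V, Fintype (G.neighborSet v)]
    {W : ℝ → ℝ → ℝ} {I J r : ℝ} (hJ : 0 ≤ J) (hr : 0 < r)
    (hW : ∀ u v : ℝ, |W u v| ≤ (I + J * (|u| ^ r + |v| ^ r)) / 2)
    {P : ℝ → ℝ} {a c p q : ℝ} (hP : ∀ u : ℝ, a * |u| ^ q - c ≤ P u) (hrp : r ≤ p)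
    (Λ : Finset V) (ξ : V → ℝ) :
    ∃ C K : ℝ, 0 ≤ K ∧ ∀ σ : ↥Λ → ℝ,
      -ham G W P Λ (comb Λ σ ξ) ≤ C + ∑ x, (K * |σ x| ^ p - a * |σ x| ^ q) := by
  set N : ℝ := ∑ x ∈ Λ, ((G.neighborFinset x).card : ℝ) with hN
  have hN0 : 0 ≤ N := Finset.sum_nonneg fun _ _ => Nat.cast_nonneg _
  set B : ℝ := ∑ x ∈ Λ, ∑ y ∈ G.neighborFinset x, (I / 2 + J / 2 * |ξ y| ^ r) with hB
  refine ⟨B + Λ.card * c + J * N * Λ.card, J * N, mul_nonneg hJ hN0, fun σ => ?_⟩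
  set ω := comb Λ σ ξ with hω
  set Q : ℝ := ∑ x ∈ Λ, |ω x| ^ r with hQ
  have hQ0 : 0 ≤ Q := Finset.sum_nonneg fun x _ => rpow_nonneg (abs_nonneg _) _
  have hQx : ∀ x ∈ Λ, |ω x| ^ r ≤ Q := fun x hx =>
    Finset.single_le_sum (f := fun x => |ω x| ^ r) (fun x _ => rpow_nonneg (abs_nonneg _) _) hx
  have hy : ∀ y, |ω y| ^ r ≤ |ξ y| ^ r + Q := by
    intro y
    have h0 : 0 ≤ |ξ y| ^ r := rpow_nonneg (abs_nonneg _) _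
    by_cases h : y ∈ Λ
    · linarith [hQx y h]
    · rw [hω, comb_of_notMem σ ξ h]
      linarith
  have hWxy : ∀ x ∈ Λ, ∀ y, |W (ω x) (ω y)| ≤ (I / 2 + J / 2 * |ξ y| ^ r) + J * Q := by
    intro x hx y
    have h1 := mul_le_mul_of_nonneg_left (hy y) hJ
    have h2 := mul_le_mul_of_nonneg_left (hQx x hx) hJ
    linarith [hW (ω x) (ω y)]
  have hsum : ∑ x ∈ Λ, ∑ y ∈ G.neighborFinset x, |W (ω x) (ω y)| ≤ B + J * N * Q := by
    calc ∑ x ∈ Λ, ∑ y ∈ G.neighborFinset x, |W (ω x) (ω y)|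
        ≤ ∑ x ∈ Λ, ∑ y ∈ G.neighborFinset x, ((I / 2 + J / 2 * |ξ y| ^ r) + J * Q) :=
          Finset.sum_le_sum fun x hx => Finset.sum_le_sum fun y _ => hWxy x hx y
      _ = B + J * N * Q := by
          have e : ∀ x ∈ Λ, ∑ y ∈ G.neighborFinset x, ((I / 2 + J / 2 * |ξ y| ^ r) + J * Q)
              = ∑ y ∈ G.neighborFinset x, (I / 2 + J / 2 * |ξ y| ^ r)
                + (G.neighborFinset x).card * (J * Q) := fun x _ => by
            rw [Finset.sum_add_distrib, Finset.sum_const, nsmul_eq_mul]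
          rw [Finset.sum_congr rfl e, Finset.sum_add_distrib, ← Finset.sum_mul]
          ring
  have hsplit : ∑ x ∈ Λ, ∑ y ∈ G.neighborFinset x, |W (ω x) (ω y)|
      = ∑ x ∈ Λ, ∑ y ∈ G.neighborFinset x ∩ Λ, |W (ω x) (ω y)|
        + ∑ x ∈ Λ, ∑ y ∈ G.neighborFinset x \ Λ, |W (ω x) (ω y)| := by
    rw [← Finset.sum_add_distrib]
    exact Finset.sum_congr rfl fun x _ => (Finset.sum_inter_add_sum_sdiff _ _ _).symm
  have h1 : -∑ x ∈ Λ, ∑ y ∈ G.neighborFinset x ∩ Λ, |W (ω x) (ω y)|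
      ≤ ∑ x ∈ Λ, ∑ y ∈ G.neighborFinset x ∩ Λ, W (ω x) (ω y) := by
    simp only [← Finset.sum_neg_distrib]
    exact Finset.sum_le_sum fun x _ => Finset.sum_le_sum fun y _ => neg_abs_le _
  have h2 : -∑ x ∈ Λ, ∑ y ∈ G.neighborFinset x \ Λ, |W (ω x) (ω y)|
      ≤ ∑ x ∈ Λ, ∑ y ∈ G.neighborFinset x \ Λ, W (ω x) (ω y) := by
    simp only [← Finset.sum_neg_distrib]
    exact Finset.sum_le_sum fun x _ => Finset.sum_le_sum fun y _ => neg_abs_le _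
  have h3 : 0 ≤ ∑ x ∈ Λ, ∑ y ∈ G.neighborFinset x ∩ Λ, |W (ω x) (ω y)| :=
    Finset.sum_nonneg fun x _ => Finset.sum_nonneg fun y _ => abs_nonneg _
  have h4 : ∑ x ∈ Λ, (a * |ω x| ^ q) - Λ.card * c ≤ ∑ x ∈ Λ, P (ω x) := by
    have := Finset.sum_le_sum fun x (_ : x ∈ Λ) => hP (ω x)
    simpa [Finset.sum_sub_distrib] using this
  have hQp : Q ≤ Λ.card + ∑ x ∈ Λ, |ω x| ^ p := by
    have h : ∀ x ∈ Λ, |ω x| ^ r ≤ 1 + |ω x| ^ p := by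
      intro x _
      have h0 : 0 ≤ |ω x| ^ p := rpow_nonneg (abs_nonneg _) _
      rcases le_total |ω x| 1 with hle | hle
      · linarith [rpow_le_one (abs_nonneg _) hle hr.le]
      · linarith [rpow_le_rpow_of_exponent_le hle hrp]
    have := Finset.sum_le_sum h
    simpa [Finset.sum_add_distrib] using this
  have h5 : J * N * Q ≤ J * N * (Λ.card + ∑ x ∈ Λ, |ω x| ^ p) :=
    mul_le_mul_of_nonneg_left hQp (mul_nonneg hJ hN0)
  have h6 : ∑ x : ↥Λ, (J * N * |σ x| ^ p - a * |σ x| ^ q)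
      = J * N * ∑ x ∈ Λ, |ω x| ^ p - ∑ x ∈ Λ, (a * |ω x| ^ q) := by
    rw [Finset.mul_sum Λ (fun x => |ω x| ^ p) (J * N), ← Finset.sum_sub_distrib, ← Finset.sum_coe_sort Λ]
    exact Finset.sum_congr rfl fun x _ => by rw [hω, comb_coe]
  rw [h6, ham]
  linarith

lemma integrable_exp_sum_rpow_sub_ham (G : SimpleGraph V) [∀ v : V, Fintype (G.neighborSet v)]
    {W : ℝ → ℝ → ℝ} (hWcont : Continuous (Function.uncurry W)) {I J r : ℝ} (hJ : 0 ≤ J)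
    (hr : 0 < r) (hW : ∀ u v : ℝ, |W u v| ≤ (I + J * (|u| ^ r + |v| ^ r)) / 2)
    {P : ℝ → ℝ} (hPcont : Continuous P) {a c p q : ℝ} (ha : 0 < a)
    (hP : ∀ u : ℝ, a * |u| ^ q - c ≤ P u) (hrp : r ≤ p) (hpq : p < q)
    (Λ : Finset V) (ξ : V → ℝ) :
    Integrable fun σ : ↥Λ → ℝ => exp (∑ x, |σ x| ^ p - ham G W P Λ (comb Λ σ ξ)) := by
  have hp : 0 < p := hr.trans_le hrp
  obtain ⟨C, K, hK, h⟩ := exists_neg_ham_le G hJ hr hW hP hrp Λ ξ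
  have hint : Integrable fun σ : ↥Λ → ℝ =>
      exp C * ∏ x, exp ((K + 1) * |σ x| ^ p - a * |σ x| ^ q) :=
    (Integrable.fintype_prod (μ := fun _ => volume) (fun _ =>
      integrable_exp_mul_rpow_sub hp hpq (by linarith : 0 ≤ K + 1) ha)).const_mul _
  have hc : Continuous fun σ : ↥Λ → ℝ =>
      exp (∑ x, |σ x| ^ p - ham G W P Λ (comb Λ σ ξ)) := by
    refine continuous_exp.comp (Continuous.sub (continuous_finsetSum _ fun x _ => ?_)
      ((continuous_ham G hWcont hPcont Λ).comp (continuous_comb Λ ξ)))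
    exact (continuous_apply x).abs.rpow_const fun _ => Or.inr hp.le
  refine hint.mono' hc.aestronglyMeasurable (Eventually.of_forall fun σ => ?_)
  rw [norm_of_nonneg (exp_pos _).le, ← exp_sum, ← exp_add]
  refine exp_le_exp.2 ?_
  have e : ∑ x : ↥Λ, ((K + 1) * |σ x| ^ p - a * |σ x| ^ q)
      = ∑ x, |σ x| ^ p + ∑ x, (K * |σ x| ^ p - a * |σ x| ^ q) := by
    rw [← Finset.sum_add_distrib]
    exact Finset.sum_congr rfl fun x _ => by ring
  linarith [h σ]

/-- A pointwise bound for the one-site conditional integrals extends to finite volumes. -/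
lemma lintegral_comb_mul_exp_neg_ham_le (G : SimpleGraph V)
    [∀ v : V, Fintype (G.neighborSet v)] {W : ℝ → ℝ → ℝ} (hWcont : Continuous (Function.uncurry W))
    (hWsym : ∀ u v : ℝ, W u v = W v u) {P : ℝ → ℝ} (hPcont : Continuous P) {Λ : Finset V} {x : V}
    (hx : x ∈ Λ) (ξ : V → ℝ) {f : ℝ → ℝ≥0∞} (hf : Measurable f) {g : (V → ℝ) → ℝ≥0∞}
    (hg : Measurable g) (hgx : ∀ ω u, g (Function.update ω x u) = g ω)
    (h : ∀ v : V → ℝ,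
      ∫⁻ u : ℝ, f u * ENNReal.ofReal (exp (-(P u + ∑ y ∈ G.neighborFinset x, W u (v y))))
        ≤ g v * ∫⁻ u : ℝ,
          ENNReal.ofReal (exp (-(P u + ∑ y ∈ G.neighborFinset x, W u (v y))))) :
    ∫⁻ σ : ↥Λ → ℝ, f (comb Λ σ ξ x) * ENNReal.ofReal (exp (-ham G W P Λ (comb Λ σ ξ)))
      ≤ ∫⁻ σ : ↥Λ → ℝ, g (comb Λ σ ξ) * ENNReal.ofReal (exp (-ham G W P Λ (comb Λ σ ξ))) := by
  have hcomb := (continuous_comb Λ ξ).measurable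
  have hexp : Measurable fun σ : ↥Λ → ℝ =>
      ENNReal.ofReal (exp (-ham G W P Λ (comb Λ σ ξ))) := by
    have := ((continuous_ham G hWcont hPcont Λ).comp (continuous_comb Λ ξ)).measurable
    exact (measurable_exp.comp this.neg).ennreal_ofReal
  rw [volume_pi]
  refine lintegral_le_of_lmarginal_le {(⟨x, hx⟩ : ↥Λ)}
    ((hf.comp ((measurable_pi_apply x).comp hcomb)).mul hexp) ((hg.comp hcomb).mul hexp) ?_
  rw [lmarginal_singleton, lmarginal_singleton]
  intro σ
  set ω := comb Λ σ ξ with hω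
  set R := ham G W P Λ ω - (P (ω x) + ∑ y ∈ G.neighborFinset x, W (ω x) (ω y)) with hR
  have e : ∀ u : ℝ, ENNReal.ofReal (exp (-ham G W P Λ (Function.update ω x u)))
      = ENNReal.ofReal (exp (-(P u + ∑ y ∈ G.neighborFinset x, W u (ω y))))
        * ENNReal.ofReal (exp (-R)) := by
    intro u
    rw [ham_update G hWsym P hx, ← ENNReal.ofReal_mul (exp_pos _).le, ← exp_add, neg_add]
  simp only [comb_update, ← hω, hgx, e, Function.update_self, ← mul_assoc]
  rw [lintegral_mul_const' _ _ ENNReal.ofReal_ne_top, lintegral_mul_const' _ _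
    ENNReal.ofReal_ne_top]
  have hk : Measurable fun u : ℝ =>
      ENNReal.ofReal (exp (-(P u + ∑ y ∈ G.neighborFinset x, W u (ω y)))) := by
    have hF : Continuous fun u : ℝ => P u + ∑ y ∈ G.neighborFinset x, W u (ω y) := by
      refine hPcont.add (continuous_finsetSum _ fun y _ => ?_)
      exact hWcont.comp (by fun_prop : Continuous fun u : ℝ => (u, ω y))
    fun_prop
  rw [lintegral_const_mul _ hk]
  exact mul_le_mul' (h ω) le_rfl

section FiniteVolume

variable (G : SimpleGraph V) [∀ v : V, Fintype (G.neighborSet v)] {W : ℝ → ℝ → ℝ} {P : ℝ → ℝ}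
  (Λ : Finset V) (ξ : V → ℝ)

lemma lintegral_gibbsKer (hWcont : Continuous (Function.uncurry W)) (hPcont : Continuous P)
    {f : (V → ℝ) → ℝ≥0∞} (hf : Measurable f) :
    ∫⁻ ω, f ω ∂gibbsKer G W P Λ ξ = (ENNReal.ofReal (partZ G W P Λ ξ))⁻¹ *
      ∫⁻ σ : ↥Λ → ℝ, f (comb Λ σ ξ) * ENNReal.ofReal (exp (-ham G W P Λ (comb Λ σ ξ))) := by
  have hcomb := (continuous_comb Λ ξ).measurable
  have hexp : Measurable fun σ : ↥Λ → ℝ =>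
      ENNReal.ofReal (exp (-ham G W P Λ (comb Λ σ ξ))) := by
    have := ((continuous_ham G hWcont hPcont Λ).comp (continuous_comb Λ ξ)).measurable
    exact (measurable_exp.comp this.neg).ennreal_ofReal
  have hfc : Measurable fun σ : ↥Λ → ℝ => f (comb Λ σ ξ) := hf.comp hcomb
  rw [gibbsKer, lintegral_smul_measure, lintegral_map hf hcomb,
    lintegral_withDensity_eq_lintegral_mul _ hexp hfc, smul_eq_mul]
  simp only [Pi.mul_apply, mul_comm]

lemma partZ_pos (h : Integrable fun σ : ↥Λ → ℝ => exp (-ham G W P Λ (comb Λ σ ξ))) :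
    0 < partZ G W P Λ ξ :=
  integral_exp_pos h

lemma isProbabilityMeasure_gibbsKer (hWcont : Continuous (Function.uncurry W))
    (hPcont : Continuous P)
    (h : Integrable fun σ : ↥Λ → ℝ => exp (-ham G W P Λ (comb Λ σ ξ))) :
    IsProbabilityMeasure (gibbsKer G W P Λ ξ) := by
  have h1 := lintegral_gibbsKer G Λ ξ hWcont hPcont (f := fun _ => 1) measurable_const
  have h2 : ∫⁻ σ : ↥Λ → ℝ, ENNReal.ofReal (exp (-ham G W P Λ (comb Λ σ ξ)))
      = ENNReal.ofReal (partZ G W P Λ ξ) :=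
    (ofReal_integral_eq_lintegral_ofReal h (Eventually.of_forall fun σ => (exp_pos _).le)).symm
  have h3 := partZ_pos G Λ ξ h
  simp only [one_mul, lintegral_one, h2] at h1
  rw [ENNReal.inv_mul_cancel (ENNReal.ofReal_pos.2 h3).ne' ENNReal.ofReal_ne_top] at h1
  exact ⟨h1⟩

lemma integrable_exp_neg_ham_of_integrable_exp_sum {p : ℝ}
    (hWcont : Continuous (Function.uncurry W)) (hPcont : Continuous P)
    (h : Integrable fun σ : ↥Λ → ℝ => exp (∑ x, |σ x| ^ p - ham G W P Λ (comb Λ σ ξ))) :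
    Integrable fun σ : ↥Λ → ℝ => exp (-ham G W P Λ (comb Λ σ ξ)) := by
  refine h.mono' (continuous_exp.comp ((continuous_ham G hWcont hPcont Λ).comp
    (continuous_comb Λ ξ)).neg).aestronglyMeasurable (Eventually.of_forall fun σ => ?_)
  rw [norm_of_nonneg (exp_pos _).le]
  refine exp_le_exp.2 ?_
  have : 0 ≤ ∑ x, |σ x| ^ p := Finset.sum_nonneg fun x _ => rpow_nonneg (abs_nonneg _) _
  linarith

lemma lintegral_rpow_gibbsKer_ne_top {p : ℝ} (hWcont : Continuous (Function.uncurry W))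
    (hPcont : Continuous P)
    (h : Integrable fun σ : ↥Λ → ℝ => exp (∑ x, |σ x| ^ p - ham G W P Λ (comb Λ σ ξ)))
    {x : V} (hx : x ∈ Λ) : ∫⁻ ω, ENNReal.ofReal (|ω x| ^ p) ∂gibbsKer G W P Λ ξ ≠ ⊤ := by
  have hZ := partZ_pos G Λ ξ (integrable_exp_neg_ham_of_integrable_exp_sum G Λ ξ hWcont hPcont h)
  rw [lintegral_gibbsKer G Λ ξ hWcont hPcont (by fun_prop)]
  refine ENNReal.mul_ne_top (ENNReal.inv_ne_top.2 (ENNReal.ofReal_pos.2 hZ).ne')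
    (ne_top_of_le_ne_top h.lintegral_lt_top.ne (lintegral_mono fun σ => ?_))
  rw [← ENNReal.ofReal_mul (rpow_nonneg (abs_nonneg _) _)]
  refine ENNReal.ofReal_le_ofReal ?_
  rw [sub_eq_add_neg, exp_add]
  refine mul_le_mul_of_nonneg_right ?_ (exp_pos _).le
  have h1 : |comb Λ σ ξ x| ^ p ≤ ∑ x, |σ x| ^ p := by
    rw [show comb Λ σ ξ x = σ ⟨x, hx⟩ from comb_coe σ ξ ⟨x, hx⟩]
    exact Finset.single_le_sum (f := fun x => |σ x| ^ p)
      (fun x _ => rpow_nonneg (abs_nonneg _) _) (Finset.mem_univ _)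
  linarith [add_one_le_exp (∑ x, |σ x| ^ p)]

lemma lintegral_gibbsKer_of_notMem {f : ℝ → ℝ≥0∞} (hf : Measurable f)
    (hWcont : Continuous (Function.uncurry W)) (hPcont : Continuous P)
    (h : Integrable fun σ : ↥Λ → ℝ => exp (-ham G W P Λ (comb Λ σ ξ))) {x : V} (hx : x ∉ Λ) :
    ∫⁻ ω, f (ω x) ∂gibbsKer G W P Λ ξ = f (ξ x) := by
  have := isProbabilityMeasure_gibbsKer G Λ ξ hWcont hPcont h
  have h1 := lintegral_gibbsKer G Λ ξ hWcont hPcont (hf.comp (measurable_pi_apply x))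
  have h2 := lintegral_gibbsKer G Λ ξ hWcont hPcont (f := fun _ => f (ξ x)) measurable_const
  simp only [Function.comp_apply, comb_of_notMem _ ξ hx] at h1
  rw [h1, ← h2]
  simp

end FiniteVolume

lemma tsum_mul_le_two_mul_of_le_add_tsum {ι : Type*} {w N c : ι → ℝ≥0∞} {k : ι → ι → ℝ≥0∞}
    (hN : ∀ x, N x ≤ c x + ∑' y, k x y * N y) (hk : ∀ y, ∑' x, w x * k x y ≤ w y / 2)
    (hfin : ∑' x, w x * N x ≠ ⊤) : ∑' x, w x * N x ≤ 2 * ∑' x, w x * c x := by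
  set T := ∑' x, w x * N x with hT
  have h1 : T ≤ ∑' x, w x * c x + T / 2 := by
    calc T ≤ ∑' x, (w x * c x + ∑' y, w x * k x y * N y) := by
          refine ENNReal.tsum_le_tsum fun x => ?_
          calc w x * N x ≤ w x * (c x + ∑' y, k x y * N y) := by gcongr; exact hN x
            _ = _ := by
              rw [mul_add, ← ENNReal.tsum_mul_left]
              simp only [mul_assoc]
      _ = ∑' x, w x * c x + ∑' y, (∑' x, w x * k x y) * N y := by
          rw [ENNReal.tsum_add, ENNReal.tsum_comm]
          simp only [ENNReal.tsum_mul_right]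
      _ ≤ ∑' x, w x * c x + ∑' y, w y / 2 * N y := by
          gcongr with y
          exact hk y
      _ = ∑' x, w x * c x + T / 2 := by
          simp only [hT, div_eq_mul_inv, ← ENNReal.tsum_mul_right]
          congr 1
          exact tsum_congr fun y => by ring
  have h2 : T / 2 ≤ ∑' x, w x * c x := by
    have h3 : T / 2 + T / 2 ≤ ∑' x, w x * c x + T / 2 := by rwa [ENNReal.add_halves]
    exact (ENNReal.add_le_add_iff_right (ENNReal.div_ne_top hfin (by simp))).1 h3
  calc T = T / 2 + T / 2 := (ENNReal.add_halves T).symm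
    _ ≤ _ := by rw [two_mul]; gcongr

lemma isCompact_tsum_mul_rpow_le {ι : Type*} {w : ι → ℝ} (hw : ∀ x, 0 < w x) {p : ℝ} (hp : 0 < p)
    {R : ℝ≥0∞} (hR : R ≠ ⊤) :
    IsCompact {ω : ι → ℝ | ∑' x, ENNReal.ofReal (w x) * ENNReal.ofReal (|ω x| ^ p) ≤ R} := by
  refine (isCompact_univ_pi fun x : ι => isCompact_Icc
    (a := -(R.toReal / w x) ^ p⁻¹) (b := (R.toReal / w x) ^ p⁻¹)).of_isClosed_subset ?_ ?_
  · refine LowerSemicontinuous.isClosed_preimage (f := fun ω : ι → ℝ =>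
      ∑' x, ENNReal.ofReal (w x) * ENNReal.ofReal (|ω x| ^ p)) ?_ R
    refine lowerSemicontinuous_tsum fun x => Continuous.lowerSemicontinuous ?_
    simp only [← ENNReal.ofReal_mul (hw x).le]
    exact ENNReal.continuous_ofReal.comp
      (((continuous_apply x).abs.rpow_const fun _ => Or.inr hp.le).const_mul _)
  · intro ω hω x _
    have h1 : ENNReal.ofReal (w x * |ω x| ^ p) ≤ R := by
      rw [ENNReal.ofReal_mul (hw x).le]
      exact (ENNReal.le_tsum x).trans hω
    have h2 : w x * |ω x| ^ p ≤ R.toReal := (ENNReal.ofReal_le_iff_le_toReal hR).1 h1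
    have h3 : |ω x| ≤ (R.toReal / w x) ^ p⁻¹ := by
      rw [le_rpow_inv_iff_of_pos (abs_nonneg _)
        (div_nonneg ENNReal.toReal_nonneg (hw x).le) hp, le_div_iff₀ (hw x)]
      linarith
    exact abs_le.1 h3

lemma wgt_pos (G : SimpleGraph V) (o : V) (α : ℝ) (x : V) : 0 < wgt G o α x := exp_pos _

lemma wgt_le_mul_of_adj {G : SimpleGraph V} (hconn : G.Connected) (o : V) (α : ℝ) {x y : V}
    (hxy : G.Adj x y) : wgt G o α x ≤ exp |α| * wgt G o α y := by
  rw [wgt, wgt, ← exp_add]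
  refine exp_le_exp.2 ?_
  have h1 : (G.dist o x : ℝ) ≤ G.dist o y + 1 := by
    have := hconn.dist_triangle (u := o) (v := y) (w := x)
    rw [SimpleGraph.dist_eq_one_iff_adj.2 hxy.symm] at this
    exact_mod_cast this
  have h2 : (G.dist o y : ℝ) ≤ G.dist o x + 1 := by
    have := hconn.dist_triangle (u := o) (v := x) (w := y)
    rw [SimpleGraph.dist_eq_one_iff_adj.2 hxy] at this
    exact_mod_cast this
  have h3 : |(G.dist o y : ℝ) - G.dist o x| ≤ 1 := abs_le.2 ⟨by linarith, by linarith⟩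
  have h4 : α * ((G.dist o y : ℝ) - G.dist o x) ≤ |α| * 1 :=
    (le_abs_self _).trans (by rw [abs_mul]; gcongr)
  linarith

lemma summable_wgt_of_thetaFin {G : SimpleGraph V} [∀ v : V, Fintype (G.neighborSet v)]
    (hconn : G.Connected) {o : V} {α θ : ℝ} (hθ : 0 < θ) (h : ThetaFin G o α θ) :
    Summable (wgt G o α) := by
  rcases subsingleton_or_nontrivial V with hV | hV
  · exact Summable.of_finite
  refine h.of_nonneg_of_le (fun x => (wgt_pos G o α x).le) fun x => ?_
  refine le_mul_of_one_le_left (wgt_pos G o α x).le ?_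
  have hdeg : ∀ z, (1 : ℝ) ≤ G.degree z := fun z => by
    exact_mod_cast hconn.preconnected.degree_pos_of_nontrivial z
  obtain ⟨y, hy⟩ : (G.neighborFinset x).Nonempty := by
    rw [← Finset.card_pos]
    exact hconn.preconnected.degree_pos_of_nontrivial x
  calc (1 : ℝ) ≤ ((G.degree x : ℝ) * G.degree y) ^ θ :=
        one_le_rpow (one_le_mul_of_one_le_of_one_le (hdeg x) (hdeg y)) hθ.le
    _ ≤ _ := Finset.single_le_sum (f := fun y => ((G.degree x : ℝ) * G.degree y) ^ θ)
        (fun y _ => by positivity) hy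

section Couplings

variable (G : SimpleGraph V) [∀ v : V, Fintype (G.neighborSet v)]

lemma one_le_degree_of_mem_neighborFinset {x y : V} (h : y ∈ G.neighborFinset x) :
    (1 : ℝ) ≤ G.degree x ∧ (1 : ℝ) ≤ G.degree y := by
  have hxy := (G.mem_neighborFinset x y).1 h
  refine ⟨?_, ?_⟩
  · exact_mod_cast (G.degree_pos_iff_exists_adj x).2 ⟨y, hxy⟩
  · exact_mod_cast (G.degree_pos_iff_exists_adj y).2 ⟨x, hxy.symm⟩

lemma div_degree_mul_degree_mem {ε : ℝ} (hε : 0 < ε) (hε1 : ε ≤ 1) {x y : V}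
    (h : y ∈ G.neighborFinset x) :
    0 < ε / (G.degree x * G.degree y : ℝ) ∧ ε / (G.degree x * G.degree y : ℝ) ≤ 1 := by
  obtain ⟨h1, h2⟩ := one_le_degree_of_mem_neighborFinset G h
  have h3 : (1 : ℝ) ≤ G.degree x * G.degree y := one_le_mul_of_one_le_of_one_le h1 h2
  exact ⟨by positivity, (div_le_one (by linarith)).2 (by linarith)⟩

lemma sum_div_degree_mul_degree_le {ε : ℝ} (hε : 0 < ε) (x : V) :
    ∑ y ∈ G.neighborFinset x, ε / (G.degree x * G.degree y : ℝ) ≤ ε := by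
  rcases (G.neighborFinset x).eq_empty_or_nonempty with h0 | ⟨z, hz⟩
  · simpa [h0] using hε.le
  have hx := (one_le_degree_of_mem_neighborFinset G hz).1
  calc ∑ y ∈ G.neighborFinset x, ε / (G.degree x * G.degree y : ℝ)
      ≤ ∑ y ∈ G.neighborFinset x, ε / (G.degree x : ℝ) := by
        refine Finset.sum_le_sum fun y hy => ?_
        have := (one_le_degree_of_mem_neighborFinset G hy).2
        exact div_le_div_of_nonneg_left hε.le (by linarith)
          (le_mul_of_one_le_right (by linarith) this)
    _ = ε := by
        rw [Finset.sum_const, nsmul_eq_mul, SimpleGraph.card_neighborFinset_eq_degree]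
        field_simp

end Couplings

lemma lintegral_rpow_gibbsKer_le (G : SimpleGraph V) [∀ v : V, Fintype (G.neighborSet v)]
    {W : ℝ → ℝ → ℝ} {P : ℝ → ℝ} {Λ : Finset V} (ξ : V → ℝ)
    (hWcont : Continuous (Function.uncurry W)) (hWsym : ∀ u v : ℝ, W u v = W v u)
    (hPcont : Continuous P) [IsProbabilityMeasure (gibbsKer G W P Λ ξ)] {x : V} (hx : x ∈ Λ)
    {p A : ℝ} {κ : V → ℝ} (hA : 0 ≤ A) (hκ : ∀ y ∈ G.neighborFinset x, 0 ≤ κ y)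
    (h : ∀ v : V → ℝ,
      ∫⁻ u : ℝ, ENNReal.ofReal (|u| ^ p) *
          ENNReal.ofReal (exp (-(P u + ∑ y ∈ G.neighborFinset x, W u (v y))))
        ≤ ENNReal.ofReal (A + ∑ y ∈ G.neighborFinset x, κ y * |v y| ^ p) * ∫⁻ u : ℝ,
          ENNReal.ofReal (exp (-(P u + ∑ y ∈ G.neighborFinset x, W u (v y))))) :
    ∫⁻ ω, ENNReal.ofReal (|ω x| ^ p) ∂gibbsKer G W P Λ ξ ≤ ENNReal.ofReal A +
      ∑ y ∈ G.neighborFinset x, ENNReal.ofReal (κ y) *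
        ∫⁻ ω, ENNReal.ofReal (|ω y| ^ p) ∂gibbsKer G W P Λ ξ := by
  have hg : Measurable fun ω : V → ℝ =>
      ENNReal.ofReal (A + ∑ y ∈ G.neighborFinset x, κ y * |ω y| ^ p) := by fun_prop
  have key := lintegral_comb_mul_exp_neg_ham_le G hWcont hWsym hPcont hx ξ
    (f := fun u => ENNReal.ofReal (|u| ^ p)) (by fun_prop) hg ?_ h
  · calc ∫⁻ ω, ENNReal.ofReal (|ω x| ^ p) ∂gibbsKer G W P Λ ξ
        ≤ ∫⁻ ω, ENNReal.ofReal (A + ∑ y ∈ G.neighborFinset x, κ y * |ω y| ^ p)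
            ∂gibbsKer G W P Λ ξ := by
          rw [lintegral_gibbsKer G Λ ξ hWcont hPcont (by fun_prop),
            lintegral_gibbsKer G Λ ξ hWcont hPcont hg]
          exact mul_le_mul' le_rfl key
      _ = ∫⁻ ω, (ENNReal.ofReal A + ∑ y ∈ G.neighborFinset x,
            ENNReal.ofReal (κ y) * ENNReal.ofReal (|ω y| ^ p)) ∂gibbsKer G W P Λ ξ := by
          refine lintegral_congr fun ω => ?_
          have h0 : ∀ y ∈ G.neighborFinset x, 0 ≤ κ y * |ω y| ^ p := fun y hy =>
            mul_nonneg (hκ y hy) (rpow_nonneg (abs_nonneg _) _)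
          rw [ENNReal.ofReal_add hA (Finset.sum_nonneg h0), ENNReal.ofReal_sum_of_nonneg h0]
          congr 1
          exact Finset.sum_congr rfl fun y hy => ENNReal.ofReal_mul (hκ y hy)
      _ = _ := by
          rw [lintegral_add_left measurable_const, lintegral_const, measure_univ, mul_one,
            lintegral_finsetSum _ (fun y _ => by fun_prop)]
          congr 1
          exact Finset.sum_congr rfl fun y _ => lintegral_const_mul' _ _ ENNReal.ofReal_ne_top
  · intro ω u
    congr 2
    refine Finset.sum_congr rfl fun y hy => ?_
    rw [Function.update_of_ne ((G.mem_neighborFinset x y).1 hy).ne']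

/-- Uniform weighted moment bounds for the local specification. -/
lemma exists_tsum_lintegral_gibbsKer_le (G : SimpleGraph V) [∀ v : V, Fintype (G.neighborSet v)]
    (hconn : G.Connected) {o : V} {θ α : ℝ} (hθ : 0 < θ) (hΘ : ThetaFin G o α θ)
    {W : ℝ → ℝ → ℝ} (hWcont : Continuous (Function.uncurry W))
    (hWsym : ∀ u v : ℝ, W u v = W v u) {I J r : ℝ} (hI : 0 ≤ I) (hJ : 0 ≤ J) (hr : 0 < r)
    (hW : ∀ u v : ℝ, |W u v| ≤ (I + J * (|u| ^ r + |v| ^ r)) / 2)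
    {P : ℝ → ℝ} (hPcont : Continuous P) {a c p q : ℝ} (ha : 0 < a) (hc : 0 ≤ c)
    (hP : ∀ u : ℝ, a * |u| ^ q - c ≤ P u) (hp : r + r / θ ≤ p) (hpq : p < q)
    {ξ : V → ℝ} (hξ : ξ ∈ tempered G o p α) :
    ∃ B : ℝ≥0∞, B ≠ ⊤ ∧ ∀ Λ : Finset V,
      ∑' x, ENNReal.ofReal (wgt G o α x) *
        ∫⁻ ω, ENNReal.ofReal (|ω x| ^ p) ∂gibbsKer G W P Λ ξ ≤ B := by
  have hrp : r ≤ p := by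
    have : 0 < r / θ := by positivity
    linarith
  have hint : ∀ Λ : Finset V, _ := fun Λ =>
    integrable_exp_sum_rpow_sub_ham G hWcont hJ hr hW hPcont ha hP hrp hpq Λ ξ
  obtain ⟨C, hC, hsite⟩ := exists_lintegral_rpow_mul_exp_le (ι := V) hWcont hI hJ hr hθ hW hPcont
    ha hc hP hp hpq
  set ε : ℝ := (2 * (J + 1) * exp |α|)⁻¹ with hε
  have hexp1 : 1 ≤ exp |α| := one_le_exp (abs_nonneg α)
  have hε0 : 0 < ε := by positivity
  have hε1 : ε ≤ 1 := by
    refine inv_le_one_of_one_le₀ ?_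
    nlinarith
  have hJε : exp |α| * (J * ε) ≤ 1 / 2 := by
    rw [hε]
    field_simp
    linarith
  set δ : V → V → ℝ := fun x y => ε / (G.degree x * G.degree y : ℝ) with hδ
  set m : V → ℝ := fun x => ∑ y ∈ G.neighborFinset x, ((G.degree x : ℝ) * G.degree y) ^ θ with hm
  set A : V → ℝ := fun x => C * (1 + ∑ y ∈ G.neighborFinset x, δ x y ^ (-θ)) with hA
  have hAm : ∀ x, A x = C * (1 + ε ^ (-θ) * m x) := by
    intro x
    simp only [hA, hm, hδ, Finset.mul_sum]
    congr 2
    refine Finset.sum_congr rfl fun y _ => ?_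
    rw [div_rpow hε0.le (by positivity), rpow_neg (by positivity : (0 : ℝ) ≤ G.degree x * G.degree y),
      div_inv_eq_mul]
  have hA0 : ∀ x, 0 ≤ A x := fun x => mul_nonneg hC (add_nonneg zero_le_one
    (Finset.sum_nonneg fun y hy => rpow_nonneg (div_degree_mul_degree_mem G hε0 hε1 hy).1.le _))
  have hAsum : ∑' x, ENNReal.ofReal (wgt G o α x) * ENNReal.ofReal (A x) ≠ ⊤ := by
    have h : Summable fun x => wgt G o α x * A x := by
      have h1 := (summable_wgt_of_thetaFin hconn hθ hΘ).mul_left C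
      have h2 : Summable fun x => C * ε ^ (-θ) * (m x * wgt G o α x) := hΘ.mul_left _
      refine (h1.add h2).congr fun x => ?_
      rw [hAm]
      ring
    simp only [← ENNReal.ofReal_mul (wgt_pos G o α _).le]
    exact h.tsum_ofReal_ne_top
  have hξsum : ∑' x, ENNReal.ofReal (wgt G o α x) * ENNReal.ofReal (|ξ x| ^ p) ≠ ⊤ := by
    simp only [← ENNReal.ofReal_mul (wgt_pos G o α _).le, mul_comm (wgt G o α _)]
    exact Summable.tsum_ofReal_ne_top hξ
  set w : V → ℝ≥0∞ := fun x => ENNReal.ofReal (wgt G o α x) with hw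
  set k : V → V → ℝ≥0∞ := fun x y =>
    (G.neighborFinset x : Set V).indicator (fun y => ENNReal.ofReal (J * δ x y)) y with hk
  refine ⟨2 * ∑' x, w x * (ENNReal.ofReal (A x) + ENNReal.ofReal (|ξ x| ^ p)), ?_, fun Λ => ?_⟩
  · simp only [mul_add, ENNReal.tsum_add]
    exact ENNReal.add_ne_top.2 ⟨ENNReal.mul_ne_top (by simp) hAsum,
      ENNReal.mul_ne_top (by simp) hξsum⟩
  have hint' := integrable_exp_neg_ham_of_integrable_exp_sum G Λ ξ hWcont hPcont (hint Λ)
  have hprob := isProbabilityMeasure_gibbsKer G Λ ξ hWcont hPcont hint'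
  set N : V → ℝ≥0∞ := fun x => ∫⁻ ω, ENNReal.ofReal (|ω x| ^ p) ∂gibbsKer G W P Λ ξ with hN
  have hNout : ∀ x, x ∉ Λ → N x = ENNReal.ofReal (|ξ x| ^ p) := fun x hx =>
    lintegral_gibbsKer_of_notMem G Λ ξ (f := fun u => ENNReal.ofReal (|u| ^ p)) (by fun_prop)
      hWcont hPcont hint' hx
  refine tsum_mul_le_two_mul_of_le_add_tsum (k := k) (fun x => ?_) (fun y => ?_) ?_
  · by_cases hx : x ∈ Λ
    · have h1 := lintegral_rpow_gibbsKer_le G ξ hWcont hWsym hPcont hx (p := p)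
        (κ := fun y => J * δ x y) (hA0 x)
        (fun y hy => mul_nonneg hJ (div_degree_mul_degree_mem G hε0 hε1 hy).1.le) (fun v => by
          have := hsite (G.neighborFinset x) (δ x) v
            (fun y hy => div_degree_mul_degree_mem G hε0 hε1 hy)
            ((sum_div_degree_mul_degree_le G hε0 x).trans hε1)
          simpa only [Finset.mul_sum (G.neighborFinset x) _ J, mul_assoc] using this)
      have h2 : ∑' y, k x y * N y
          = ∑ y ∈ G.neighborFinset x, ENNReal.ofReal (J * δ x y) * N y := by
        rw [tsum_eq_sum (s := G.neighborFinset x) (fun y hy => by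
          rw [hk]
          simp only [Set.indicator_of_notMem (Finset.mem_coe.not.2 hy), zero_mul])]
        exact Finset.sum_congr rfl fun y hy => by
          rw [hk]
          simp only [Set.indicator_of_mem (Finset.mem_coe.2 hy)]
      rw [h2]
      exact h1.trans (add_le_add_left le_self_add _)
    · exact (hNout x hx).le.trans (le_add_right le_add_self)
  · have hsymm : ∀ x, k x y ≠ 0 → x ∈ G.neighborFinset y := fun x hx => by
      have := Set.mem_of_indicator_ne_zero hx
      simp only [Finset.mem_coe, SimpleGraph.mem_neighborFinset] at this ⊢
      exact this.symm
    rw [tsum_eq_sum (s := G.neighborFinset y) (fun x hx => by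
      rw [not_imp_comm.1 (hsymm x) hx, mul_zero])]
    calc ∑ x ∈ G.neighborFinset y, w x * k x y
        ≤ ∑ x ∈ G.neighborFinset y,
            ENNReal.ofReal (exp |α| * wgt G o α y * J * δ y x) := by
          refine Finset.sum_le_sum fun x hx => ?_
          have hδ0 := (div_degree_mul_degree_mem G hε0 hε1 hx).1
          have hxy : δ x y = δ y x := by simp only [hδ, mul_comm]
          have hle : k x y ≤ ENNReal.ofReal (J * δ y x) := by
            rw [← hxy]
            exact Set.indicator_le_self' (fun _ _ => zero_le) y
          calc w x * k x y
              ≤ ENNReal.ofReal (exp |α| * wgt G o α y) * ENNReal.ofReal (J * δ y x) :=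
                mul_le_mul' (ENNReal.ofReal_le_ofReal (wgt_le_mul_of_adj hconn o α
                  ((G.mem_neighborFinset y x).1 hx).symm)) hle
            _ = _ := by
                rw [← ENNReal.ofReal_mul (mul_pos (exp_pos _) (wgt_pos G o α y)).le, mul_assoc _ J]
      _ = ENNReal.ofReal (∑ x ∈ G.neighborFinset y, exp |α| * wgt G o α y * J * δ y x) := by
          rw [ENNReal.ofReal_sum_of_nonneg fun x hx => ?_]
          exact mul_nonneg (mul_nonneg (mul_pos (exp_pos _) (wgt_pos G o α y)).le hJ)
            (div_degree_mul_degree_mem G hε0 hε1 hx).1.le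
      _ ≤ ENNReal.ofReal (wgt G o α y / 2) := by
          refine ENNReal.ofReal_le_ofReal ?_
          rw [← Finset.mul_sum]
          have h1 := sum_div_degree_mul_degree_le G hε0 y
          have hwy := (wgt_pos G o α y).le
          calc exp |α| * wgt G o α y * J * ∑ x ∈ G.neighborFinset y, δ y x
              ≤ exp |α| * wgt G o α y * J * ε := by gcongr
            _ = wgt G o α y * (exp |α| * (J * ε)) := by ring
            _ ≤ wgt G o α y * (1 / 2) := by gcongr
            _ = _ := by ring
      _ = w y / 2 := by
          rw [ENNReal.ofReal_div_of_pos two_pos, ENNReal.ofReal_ofNat]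
  · have hle : ∑' x, w x * N x ≤ ∑ x ∈ Λ, w x * N x + ∑' x, w x * ENNReal.ofReal (|ξ x| ^ p) := by
      rw [← Finset.tsum_subtype' Λ (fun x => w x * N x),
        tsum_subtype (Λ : Set V) (fun x => w x * N x), ← ENNReal.tsum_add]
      refine ENNReal.tsum_le_tsum fun x => ?_
      by_cases hx : x ∈ Λ
      · rw [Set.indicator_of_mem (Finset.mem_coe.2 hx)]
        exact le_self_add
      · rw [hNout x hx]
        exact le_add_self
    refine ne_top_of_le_ne_top (ENNReal.add_ne_top.2 ⟨?_, hξsum⟩) hle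
    exact ENNReal.sum_ne_top.2 fun x hx => ENNReal.mul_ne_top ENNReal.ofReal_ne_top
      (lintegral_rpow_gibbsKer_ne_top G Λ ξ hWcont hPcont (hint Λ) hx)

/-- **Relative weak compactness of the specification (Corollary).** Fix `p ∈ [p₀,q)` and
`α ∈ (α_,ᾱ]`. For every `ξ ∈ L^p(V,w_α)`, the family `{π_Λ(·|ξ) : Λ finite}` is uniformly
tight and relatively compact in the weak topology of probability measures on `Ω = ℝ^V`. -/
theorem relative_weak_compactness_of_specification
    (G : SimpleGraph V) [∀ v : V, Fintype (G.neighborSet v)] (hconn : G.Connected)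
    (o : V) (θ : ℝ) (hθ : 0 < θ)
    (αlow αbar : ℝ) (hαlow : αlow = sInf {α : ℝ | ThetaFin G o α θ})
    (hbar : αlow < αbar) (hΘ : ∀ α ∈ Set.Ioc αlow αbar, ThetaFin G o α θ)
    (W : ℝ → ℝ → ℝ) (hWcont : Continuous (Function.uncurry W))
    (hWsym : ∀ u v : ℝ, W u v = W v u)
    (IW JW r : ℝ) (hIW : 0 < IW) (hJW : 0 < JW) (hr : 0 < r)
    (hW : ∀ u v : ℝ, |W u v| ≤ (IW + JW * (|u| ^ r + |v| ^ r)) / 2)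
    (P : ℝ → ℝ) (hPcont : Continuous P)
    (aV cV q : ℝ) (haV : 0 < aV) (hcV : 0 < cV) (hq : r + r / θ < q)
    (hP : ∀ u : ℝ, aV * |u| ^ q - cV ≤ P u)
    (p α : ℝ) (hp : p ∈ Set.Ico (r + r / θ) q) (hα : α ∈ Set.Ioc αlow αbar)
    (ξ : V → ℝ) (hξ : ξ ∈ tempered G o p α) :
    (∀ ε : ℝ≥0∞, 0 < ε → ∃ K : Set (V → ℝ), IsCompact K ∧
      ∀ Λ : Finset V, gibbsKer G W P Λ ξ Kᶜ ≤ ε) ∧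
    IsCompact (closure {ν : ProbabilityMeasure (V → ℝ) |
      ∃ Λ : Finset V, ν.toMeasure = gibbsKer G W P Λ ξ}) := by
  have hp0 : 0 < p := lt_of_lt_of_le (by positivity) hp.1
  obtain ⟨B, hB, hbound⟩ := exists_tsum_lintegral_gibbsKer_le G hconn hθ (hΘ α hα) hWcont hWsym
    hIW.le hJW.le hr hW hPcont haV hcV.le hP hp.1 hp.2 hξ
  have htight : ∀ ε : ℝ≥0∞, 0 < ε → ∃ K : Set (V → ℝ), IsCompact K ∧
      ∀ Λ : Finset V, gibbsKer G W P Λ ξ Kᶜ ≤ ε := by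
    intro ε hε
    rcases eq_or_ne ε ⊤ with rfl | hεtop
    · exact ⟨∅, isCompact_empty, fun Λ => le_top⟩
    have hR : B / ε + 1 ≠ ⊤ := ENNReal.add_ne_top.2 ⟨ENNReal.div_ne_top hB hε.ne', by simp⟩
    refine ⟨_, isCompact_tsum_mul_rpow_le (wgt_pos G o α) hp0 hR, fun Λ => ?_⟩
    set f : (V → ℝ) → ℝ≥0∞ := fun ω =>
      ∑' x, ENNReal.ofReal (wgt G o α x) * ENNReal.ofReal (|ω x| ^ p) with hf
    have hterm : ∀ x, Measurable fun ω : V → ℝ =>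
        ENNReal.ofReal (wgt G o α x) * ENNReal.ofReal (|ω x| ^ p) :=
      fun x => Measurable.const_mul (by fun_prop) _
    have hfm : Measurable f := Measurable.tsum hterm
    have hfint : ∫⁻ ω, f ω ∂gibbsKer G W P Λ ξ ≤ B := by
      rw [lintegral_tsum fun x => (hterm x).aemeasurable]
      simpa only [lintegral_const_mul' _ _ ENNReal.ofReal_ne_top] using hbound Λ
    calc gibbsKer G W P Λ ξ {ω | f ω ≤ B / ε + 1}ᶜ
        ≤ gibbsKer G W P Λ ξ {ω | B / ε + 1 ≤ f ω} :=
          measure_mono fun ω hω => (not_le.1 (show ¬ f ω ≤ B / ε + 1 from hω)).le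
      _ ≤ (∫⁻ ω, f ω ∂gibbsKer G W P Λ ξ) / (B / ε + 1) :=
          meas_ge_le_lintegral_div hfm.aemeasurable (by simp) hR
      _ ≤ ε := by
          refine ENNReal.div_le_of_le_mul (hfint.trans ?_)
          rw [mul_add, ENNReal.mul_div_cancel hε.ne' hεtop]
          exact le_self_add
  refine ⟨htight, isCompact_closure_of_isTightMeasureSet ?_⟩
  rw [isTightMeasureSet_iff_exists_isCompact_measure_compl_le]
  intro ε hε
  obtain ⟨K, hK, hKε⟩ := htight ε hε
  refine ⟨K, hK, ?_⟩
  rintro _ ⟨ν, ⟨Λ, hν⟩, rfl⟩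
  rw [hν]
  exact hKε Λ
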